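/- Let Λ be an artin algebra. If X is a Gabriel-Roiter submodule of some module Y, then there exists an irreducible monomorphism X → M with M indecomposable. -/

import Mathlib

/-!
Setting: `k` is a commutative artinian ring and `Λ` an artin `k`-algebra
(an algebra over `k` which is finitely generated as a `k`-module).
All modules considered are `Λ`-modules of finite length (`IsFiniteLength Λ M`),
and `|M|` denotes the length of `M`, implemented as the height
`Order.height (⊤ : Submodule Λ M)` of the lattice of submodules
(for a submodule `N` of an ambient module, its length is `Order.height N`).
-/

universe u v

open Submodule

section GRDefs

variable (Λ : Type u) [Ring Λ]

/-- A submodule `N` of an ambient module is indecomposable (as a module):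
it is nonzero, and whenever it is the direct sum of two submodules, one of them is zero. -/
def IndecSub {Y : Type v} [AddCommGroup Y] [Module Λ Y] (N : Submodule Λ Y) : Prop :=
  N ≠ ⊥ ∧ ∀ A B : Submodule Λ Y, A ≤ N → B ≤ N → A ⊔ B = N → A ⊓ B = ⊥ → A = ⊥ ∨ B = ⊥

/-- A module is indecomposable iff its top submodule is. -/
def IndecMod (M : Type v) [AddCommGroup M] [Module Λ M] : Prop :=
  IndecSub Λ (⊤ : Submodule Λ M)

/-- The length `|M|` of a module, as an extended natural number. -/
noncomputable def modLen (M : Type v) [AddCommGroup M] [Module Λ M] : ℕ∞ :=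
  Order.height (⊤ : Submodule Λ M)

/-- The length `|N|` of a submodule of an ambient module, as a natural number. -/
noncomputable def subLen {Y : Type v} [AddCommGroup Y] [Module Λ Y] (N : Submodule Λ Y) : ℕ :=
  (Order.height N).toNat

open Classical in
/-- Fuel-based auxiliary function for the Gabriel-Roiter measure. -/
noncomputable def muAux {Y : Type v} [AddCommGroup Y] [Module Λ Y] :
    ℕ → Submodule Λ Y → ℝ
  | 0, _ => 0
  | n + 1, N =>
      (if IndecSub Λ N then (2 : ℝ) ^ (-(subLen Λ N : ℤ)) else 0)
        + sSup (muAux n '' {N' : Submodule Λ Y | N' < N})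

/-- The Gabriel-Roiter measure `μ(N)` of a submodule `N` of an ambient module:
`μ(0) = 0`; if `N ≠ 0` is decomposable, `μ(N)` is the maximum of `μ(N')` over proper
submodules `N'` of `N`; if `N` is indecomposable, `μ(N) = 2^(-|N|)` plus this maximum.
(For modules of finite length the supremum is a maximum and the fuel `|N|` suffices for
the recursion, so this agrees with the usual inductive definition; the measure of a
submodule depends only on the sublattice of its submodules, hence it does not matter
in which ambient module it is computed.) -/
noncomputable def mu {Y : Type v} [AddCommGroup Y] [Module Λ Y] (N : Submodule Λ Y) : ℝ :=
  muAux Λ (subLen Λ N) N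

/-- The Gabriel-Roiter measure of a module. -/
noncomputable def muMod (M : Type v) [AddCommGroup M] [Module Λ M] : ℝ :=
  mu Λ (⊤ : Submodule Λ M)

/-- `X` is a Gabriel-Roiter submodule of the (indecomposable, non-simple) ambient
module `Y`: `X` is an indecomposable proper submodule with `μ(Y) = μ(X) + 2^(-|Y|)`. -/
def IsGRSub {Y : Type v} [AddCommGroup Y] [Module Λ Y] (X : Submodule Λ Y) : Prop :=
  IndecMod Λ Y ∧ IndecSub Λ X ∧ X ≠ ⊤ ∧
    mu Λ (⊤ : Submodule Λ Y) = mu Λ X + (2 : ℝ) ^ (-(subLen Λ (⊤ : Submodule Λ Y) : ℤ))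

/-- A map `u : X → Y` is a Gabriel-Roiter inclusion iff it is injective and its
image is a Gabriel-Roiter submodule of `Y`. -/
def IsGRInclusion {X Y : Type v} [AddCommGroup X] [Module Λ X] [AddCommGroup Y] [Module Λ Y]
    (u : X →ₗ[Λ] Y) : Prop :=
  Function.Injective u ∧ IsGRSub Λ (LinearMap.range u)

/-- A linear map is a split monomorphism. -/
def IsSplitMonoHom {A B : Type v} [AddCommGroup A] [Module Λ A] [AddCommGroup B] [Module Λ B]
    (f : A →ₗ[Λ] B) : Prop :=
  ∃ g : B →ₗ[Λ] A, g.comp f = LinearMap.id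

/-- A linear map is a split epimorphism. -/
def IsSplitEpiHom {A B : Type v} [AddCommGroup A] [Module Λ A] [AddCommGroup B] [Module Λ B]
    (f : A →ₗ[Λ] B) : Prop :=
  ∃ g : B →ₗ[Λ] A, f.comp g = LinearMap.id

/-- A morphism `f` in the category of finite length `Λ`-modules is irreducible if it is
neither a split monomorphism nor a split epimorphism and, whenever `f = g ∘ h` with the
intermediate module of finite length, either `h` is a split monomorphism or `g` is a
split epimorphism. -/
def IsIrreducibleHom {A B : Type v} [AddCommGroup A] [Module Λ A] [AddCommGroup B] [Module Λ B]
    (f : A →ₗ[Λ] B) : Prop :=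
  ¬ IsSplitMonoHom Λ f ∧ ¬ IsSplitEpiHom Λ f ∧
    ∀ (Z : Type v) [AddCommGroup Z] [Module Λ Z], IsFiniteLength Λ Z →
      ∀ (h : A →ₗ[Λ] Z) (g : Z →ₗ[Λ] B), f = g.comp h →
        IsSplitMonoHom Λ h ∨ IsSplitEpiHom Λ g

/-- An indecomposable submodule `U` of the ambient module is piling provided
`μ(V) ≤ μ(U)` for every indecomposable submodule `V` with `|V| ≤ |U|`. -/
def IsPilingSub {Y : Type v} [AddCommGroup Y] [Module Λ Y] (U : Submodule Λ Y) : Prop :=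
  IndecSub Λ U ∧ ∀ V : Submodule Λ Y, IndecSub Λ V →
    Order.height V ≤ Order.height U → mu Λ V ≤ mu Λ U

/-- A Gabriel-Roiter filtration `c 0 ⊂ c 1 ⊂ ⋯ ⊂ c t = N` of an (indecomposable)
submodule `N`: a chain of indecomposable submodules starting at a simple module such
that each inclusion `c i ⊂ c (i+1)` is a Gabriel-Roiter inclusion,
i.e. `μ(c (i+1)) = μ(c i) + 2^(-|c (i+1)|)`. -/
def IsGRFiltration {Y : Type v} [AddCommGroup Y] [Module Λ Y] {t : ℕ}
    (c : Fin (t + 1) → Submodule Λ Y) (N : Submodule Λ Y) : Prop :=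
  c (Fin.last t) = N ∧
  IsSimpleModule Λ (c 0) ∧
  (∀ i : Fin (t + 1), IndecSub Λ (c i)) ∧
  ∀ i : Fin t, c i.castSucc < c i.succ ∧
    mu Λ (c i.succ) = mu Λ (c i.castSucc) + (2 : ℝ) ^ (-(subLen Λ (c i.succ) : ℤ))

/-- A brick: a nonzero module all of whose nonzero endomorphisms are invertible
(i.e. the endomorphism ring is a division ring). -/
def IsBrick (M : Type v) [AddCommGroup M] [Module Λ M] : Prop :=
  (∃ x : M, x ≠ 0) ∧ ∀ f : M →ₗ[Λ] M, f ≠ 0 → Function.Bijective f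

/-- An `M`-filtration `0 = c 0 ⊂ c 1 ⊂ ⋯ ⊂ c m = Y` of the module `Y`
(so `c j` is the module `M[j]`, with `M[0] = 0`, and the `M`-length of `Y` is `m`):
all consecutive factors `c (i+1) / c i` are isomorphic to `M`. -/
structure IsMFiltration (M : Type v) [AddCommGroup M] [Module Λ M]
    {Y : Type v} [AddCommGroup Y] [Module Λ Y] {m : ℕ}
    (c : Fin (m + 1) → Submodule Λ Y) : Prop where
  bot : c 0 = ⊥
  top : c (Fin.last m) = ⊤
  lt : ∀ i : Fin m, c i.castSucc < c i.succ
  quot : ∀ i : Fin m,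
    Nonempty ((↥(c i.succ) ⧸ comap (c i.succ).subtype (c i.castSucc)) ≃ₗ[Λ] M)

/-- A homogeneous `M`-filtration: an `M`-filtration in which moreover all the
`M[i] = c i` with `i ≥ 1` are indecomposable and all the inclusions
`M[i-1] ⊂ M[i]` for `2 ≤ i ≤ m` are irreducible monomorphisms. -/
structure IsHomogMFiltration (M : Type v) [AddCommGroup M] [Module Λ M]
    {Y : Type v} [AddCommGroup Y] [Module Λ Y] {m : ℕ}
    (c : Fin (m + 1) → Submodule Λ Y) extends IsMFiltration Λ M c : Prop where
  indec : ∀ i : Fin (m + 1), i ≠ 0 → IndecSub Λ (c i)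
  irr : ∀ i : Fin m, (i : ℕ) ≠ 0 →
    IsIrreducibleHom Λ (Submodule.inclusion (toIsMFiltration.lt i).le)

end GRDefs

section Matlis

/-- Every submodule `S` of an injective module has an essential extension which is again
injective. -/
theorem exists_baer_essential {R : Type*} [Ring R] {I : Type*} [AddCommGroup I] [Module R I]
    (hI : Module.Baer R I) (S : Submodule R I) :
    ∃ E : Submodule R I, S ≤ E ∧ (∀ x ∈ E, x ≠ 0 → ∃ r : R, r • x ≠ 0 ∧ r • x ∈ S) ∧
      Module.Baer R E := by
  obtain ⟨E, hSE, hEmax⟩ := zorn_le_nonempty₀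
    {T : Submodule R I | ∀ x ∈ T, x ≠ 0 → ∃ r : R, r • x ≠ 0 ∧ r • x ∈ S}
    (fun c hc hchain T hT => ⟨sSup c, fun x hx hx0 => by
        obtain ⟨U, hU, hxU⟩ := (Submodule.mem_sSup_of_directed ⟨T, hT⟩ hchain.directedOn).1 hx
        exact hc hU x hxU hx0, fun U hU => le_sSup hU⟩)
    S (fun x hx hx0 => ⟨1, by simpa using hx0, by simpa using hx⟩)
  have hess : ∀ x ∈ E, x ≠ 0 → ∃ r : R, r • x ≠ 0 ∧ r • x ∈ S := hEmax.prop
  obtain ⟨N, -, hNmax⟩ := zorn_le_nonempty₀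
    {T : Submodule R I | ∀ x ∈ T, x ∈ E → x = 0}
    (fun c hc hchain T hT => ⟨sSup c, fun x hx hxE => by
        obtain ⟨U, hU, hxU⟩ := (Submodule.mem_sSup_of_directed ⟨T, hT⟩ hchain.directedOn).1 hx
        exact hc hU x hxU hxE, fun U hU => le_sSup hU⟩)
    ⊥ (fun x hx _ => by simpa using hx)
  have hN : ∀ x ∈ N, x ∈ E → x = 0 := hNmax.prop
  obtain ⟨g, hg⟩ := hI.extension_property (N.mkQ ∘ₗ E.subtype)
    (by
      rw [← LinearMap.ker_eq_bot, LinearMap.ker_eq_bot']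
      intro x hx
      exact Subtype.ext (hN x ((Submodule.Quotient.mk_eq_zero N).1 hx) x.2)) E.subtype
  have hgE : ∀ e ∈ E, g (N.mkQ e) = e := fun e he => LinearMap.congr_fun hg ⟨e, he⟩
  have key : ∀ x, x ∉ N → ∃ r : R, r • g (N.mkQ x) ≠ 0 ∧ r • g (N.mkQ x) ∈ E := by
    intro x hx
    have hlt : ¬ (N ⊔ Submodule.span R {x} ≤ N) := fun h =>
      hx (h (Submodule.mem_sup_right (Submodule.mem_span_singleton_self x)))
    have hnot : ¬ ∀ y ∈ N ⊔ Submodule.span R {x}, y ∈ E → y = 0 := fun h =>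
      hlt (hNmax.le_of_ge h le_sup_left)
    push Not at hnot
    obtain ⟨y, hy, hyE, hy0⟩ := hnot
    obtain ⟨a, ha, b, hb, rfl⟩ := Submodule.mem_sup.1 hy
    obtain ⟨r, rfl⟩ := Submodule.mem_span_singleton.1 hb
    have : r • g (N.mkQ x) = a + r • x := by
      rw [← hgE _ hyE, map_add, (Submodule.Quotient.mk_eq_zero N).2 ha |> (id : _ → N.mkQ a = 0),
        zero_add, map_smul, map_smul]
    exact ⟨r, by rwa [this], by rwa [this]⟩
  have hrange : LinearMap.range g ≤ E := by
    refine hEmax.le_of_ge ?_ (fun e he => ⟨N.mkQ e, hgE e he⟩)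
    rintro _ ⟨q, rfl⟩ hne
    obtain ⟨x, rfl⟩ := N.mkQ_surjective q
    have hx : x ∉ N := fun h => hne (by
      rw [(Submodule.Quotient.mk_eq_zero N).2 h |> (id : _ → N.mkQ x = 0), map_zero])
    obtain ⟨r, hr0, hrE⟩ := key x hx
    obtain ⟨s, hs0, hsS⟩ := hess _ hrE hr0
    exact ⟨s * r, by rwa [mul_smul], by rwa [mul_smul]⟩
  refine ⟨E, hSE, hess, fun J f => ?_⟩
  obtain ⟨f', hf'⟩ := hI J (E.subtype ∘ₗ f)
  refine ⟨(g ∘ₗ N.mkQ).codRestrict E (fun x => hrange ⟨_, rfl⟩) ∘ₗ f', fun x hx => Subtype.ext ?_⟩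
  change g (N.mkQ (f' x)) = f ⟨x, hx⟩
  rw [hf' x hx]
  exact hgE _ (f ⟨x, hx⟩).2

/-- An injective cogenerator which contains each simple module at most once. -/
theorem exists_minimal_injective_cogenerator (k : Type u) [CommRing k] :
    ∃ E : ModuleCat.{u} k, Module.Baer k E ∧
      ∀ m : Ideal k, m.IsMaximal →
        (∃ f : (k ⧸ m) →ₗ[k] E, f ≠ 0) ∧ Module.length k ((k ⧸ m) →ₗ[k] E) ≤ 1 := by
  classical
  obtain ⟨⟨I, hI, i, hi⟩⟩ := CategoryTheory.EnoughInjectives.presentation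
    (ModuleCat.of k ((m : MaximalSpectrum k) → k ⧸ m.asIdeal))
  have hi' : Function.Injective i := (ModuleCat.mono_iff_injective i).1 hi
  have hB : Module.Baer k I := by
    have : CategoryTheory.Injective (ModuleCat.of k I) := hI
    exact Module.Baer.of_injective (Module.injective_module_of_injective_object k I)
  obtain ⟨E, hSE, hess, hE⟩ := exists_baer_essential hB (LinearMap.range i.hom)
  refine ⟨ModuleCat.of k E, hE, fun m hm => ?_⟩
  let j : (k ⧸ m) →ₗ[k] E :=
    (i.hom.codRestrict E (fun x => hSE ⟨x, rfl⟩)) ∘ₗ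
      LinearMap.single k (fun m : MaximalSpectrum k => k ⧸ m.asIdeal) ⟨m, hm⟩
  have hj : Function.Injective j := by
    intro a b hab
    have := hi' (congrArg Subtype.val hab)
    exact Pi.single_injective (M := fun m : MaximalSpectrum k => k ⧸ m.asIdeal) ⟨m, hm⟩ this
  refine ⟨⟨j, fun h => ?_⟩, ?_⟩
  · have : (1 : k ⧸ m) = 0 := hj (by rw [h]; rfl)
    have : Nontrivial (k ⧸ m) := Ideal.Quotient.nontrivial_iff.2 hm.ne_top
    exact one_ne_zero ‹(1 : k ⧸ m) = 0›
  · have hmem : ∀ f : (k ⧸ m) →ₗ[k] E, f 1 ∈ LinearMap.range j := by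
      intro f
      by_cases h0 : f 1 = 0
      · rw [h0]; exact zero_mem _
      have hkill : ∀ a ∈ m, a • f 1 = 0 := by
        intro a ha
        rw [← map_smul, Algebra.smul_def, mul_one]
        have : algebraMap k (k ⧸ m) a = 0 := Ideal.Quotient.eq_zero_iff_mem.2 ha
        rw [this, map_zero]
      obtain ⟨r, hr0, x, hx⟩ := hess (f 1) (f 1).2 (fun h => h0 (Subtype.ext h))
      have hrm : r ∉ m := fun h => hr0 (congrArg Subtype.val (hkill r h))
      obtain ⟨s, hs⟩ := hm.exists_inv hrm
      obtain ⟨c, hc, hsc⟩ := hs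
      have hf1 : (f 1 : I) = i.hom (s • x) := by
        rw [map_smul, hx, ← mul_smul]
        have h1 : (s * r + c) • f 1 = f 1 := by rw [hsc, one_smul]
        rw [add_smul, hkill c hc, add_zero] at h1
        exact (congrArg Subtype.val h1).symm
      set t := s • x with ht
      have htk : ∀ a ∈ m, a • t = 0 := by
        intro a ha
        apply hi'
        change i.hom _ = i.hom _
        rw [map_smul, ← hf1, map_zero]
        exact congrArg Subtype.val (hkill a ha)
      refine ⟨t ⟨m, hm⟩, Subtype.ext ?_⟩
      rw [hf1]
      change i.hom _ = _
      congr 1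
      funext m'
      by_cases hmm : m' = ⟨m, hm⟩
      · subst hmm
        exact Pi.single_eq_same (M := fun m : MaximalSpectrum k => k ⧸ m.asIdeal) _ _
      · have hne : ¬ m ≤ m'.asIdeal := fun hle => hmm (by
          ext1; exact (hm.eq_of_le m'.isMaximal.ne_top hle).symm)
        obtain ⟨a, ha, ha'⟩ := SetLike.not_le_iff_exists.1 hne
        have h1 : a • t m' = 0 := congrFun (htk a ha) m'
        have := m'.isMaximal.isPrime
        rw [Algebra.smul_def, mul_eq_zero] at h1
        rcases h1 with h1 | h1
        · exact absurd (Ideal.Quotient.eq_zero_iff_mem.1 h1) ha'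
        · rw [h1]
          exact Pi.single_eq_of_ne (M := fun m : MaximalSpectrum k => k ⧸ m.asIdeal) hmm _
    let ev : ((k ⧸ m) →ₗ[k] E) →ₗ[k] LinearMap.range j :=
      (LinearMap.applyₗ (1 : k ⧸ m)).codRestrict _ hmem
    have hev : Function.Injective ev := by
      intro f g hfg
      have h1 : f 1 = g 1 := congrArg Subtype.val hfg
      ext
      simpa using congrArg Subtype.val h1
    have hs : IsSimpleModule k (k ⧸ m) := isSimpleModule_iff_isCoatom.2 hm.out
    calc Module.length k ((k ⧸ m) →ₗ[k] E) ≤ Module.length k (LinearMap.range j) :=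
          Module.length_le_of_injective ev hev
      _ ≤ Module.length k (k ⧸ m) :=
          Module.length_le_of_surjective j.rangeRestrict j.surjective_rangeRestrict
      _ = 1 := Module.length_eq_one k _
      _ ≤ 1 := le_rfl

theorem length_dual_le {k : Type*} [CommRing k] {E : Type*} [AddCommGroup E] [Module k E]
    (hE : ∀ m : Ideal k, m.IsMaximal → Module.length k ((k ⧸ m) →ₗ[k] E) ≤ 1)
    {M : Type*} [AddCommGroup M] [Module k M] (hM : IsFiniteLength k M) :
    Module.length k (M →ₗ[k] E) ≤ Module.length k M := by
  induction hM with
  | of_subsingleton =>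
    rw [Module.length_eq_zero]
    exact zero_le
  | @of_simple_quotient M _ _ N hs _ ih =>
    have h1 : Module.length k ((M ⧸ N) →ₗ[k] E) ≤ 1 := by
      obtain ⟨m, hm, ⟨e⟩⟩ := isSimpleModule_iff_quot_maximal.1 hs
      rw [(LinearEquiv.congrLeft E k e).length_eq]
      exact hE m hm
    let f := LinearMap.lcomp k E N.mkQ
    let g := LinearMap.lcomp k E N.subtype
    have hf : Function.Injective f := by
      intro a b hab
      ext x
      exact LinearMap.congr_fun hab x
    have hfg : Function.Exact f g.rangeRestrict := by
      intro a
      constructor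
      · intro ha
        have ha' : g a = 0 := congrArg Subtype.val ha
        refine ⟨N.liftQ a (fun x hx => LinearMap.congr_fun ha' ⟨x, hx⟩), ?_⟩
        ext x
        rfl
      · rintro ⟨b, rfl⟩
        apply Subtype.ext
        ext x
        change b (N.mkQ x) = 0
        rw [(Submodule.Quotient.mk_eq_zero N).2 x.2 |> (id : _ → N.mkQ (x : M) = 0), map_zero]
    rw [Module.length_eq_add_of_exact f g.rangeRestrict hf g.surjective_rangeRestrict hfg,
      Module.length_eq_add_of_exact N.subtype N.mkQ N.subtype_injective N.mkQ_surjective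
        (LinearMap.exact_subtype_mkQ N), add_comm, Module.length_eq_one k (M ⧸ N)]
    exact add_le_add ((Module.length_le_of_injective _ (Submodule.subtype_injective _)).trans ih) h1

/-- Matlis duality: modules of finite length are reflexive. -/
theorem exists_duality_module (k : Type u) [CommRing k] :
    ∃ E : ModuleCat.{u} k, Module.Baer k E ∧
      ∀ (M : Type v) [AddCommGroup M] [Module k M], IsFiniteLength k M →
        IsFiniteLength k (M →ₗ[k] E) ∧
        (∀ x : M, (∀ w : M →ₗ[k] E, w x = 0) → x = 0) ∧
        ∀ φ : (M →ₗ[k] E) →ₗ[k] E, ∃ x : M, ∀ w, φ w = w x := by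
  obtain ⟨E, hB, hE⟩ := exists_minimal_injective_cogenerator k
  refine ⟨E, hB, fun M _ _ hM => ?_⟩
  have hE1 := fun m hm => (hE m hm).2
  have hD : IsFiniteLength k (M →ₗ[k] E) :=
    Module.length_ne_top_iff.1 ((length_dual_le hE1 hM).trans_lt
      (Module.length_ne_top_iff.2 hM).lt_top).ne
  have hcog : ∀ x : M, (∀ w : M →ₗ[k] E, w x = 0) → x = 0 := by
    intro x hx
    by_contra hx0
    let s := LinearMap.toSpanSingleton k M x
    have hker : LinearMap.ker s ≠ ⊤ := by
      intro h
      have : (1 : k) ∈ LinearMap.ker s := h ▸ Submodule.mem_top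
      exact hx0 (by simpa [s] using this)
    obtain ⟨m, hm, hle⟩ := Ideal.exists_le_maximal _ hker
    obtain ⟨f, hf⟩ := (hE m hm).1
    have hle' : LinearMap.ker s.rangeRestrict ≤ LinearMap.ker (f ∘ₗ Submodule.mkQ m) := by
      rw [LinearMap.ker_rangeRestrict]
      intro a ha
      have : Submodule.mkQ m a = 0 := (Submodule.Quotient.mk_eq_zero m).2 (hle ha)
      rw [LinearMap.mem_ker, LinearMap.comp_apply, this, map_zero]
    obtain ⟨g, hg⟩ := hB.extension_property
      ((LinearMap.ker s).liftQ s le_rfl)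
      (LinearMap.ker_eq_bot.1 (Submodule.ker_liftQ_eq_bot _ _ _ le_rfl))
      ((LinearMap.ker s).liftQ (f ∘ₗ Submodule.mkQ m) (by
        rwa [LinearMap.ker_rangeRestrict] at hle'))
    apply hf
    ext
    have := LinearMap.congr_fun hg (Submodule.Quotient.mk (1 : k))
    simp only [LinearMap.comp_apply, Submodule.liftQ_apply] at this
    have h1 : s 1 = x := by simp [s]
    rw [h1, hx g] at this
    exact this.symm
  refine ⟨hD, hcog, ?_⟩
  let ev : M →ₗ[k] ((M →ₗ[k] E) →ₗ[k] E) := LinearMap.applyₗ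
  have hev : Function.Injective ev := by
    rw [← LinearMap.ker_eq_bot, LinearMap.ker_eq_bot']
    exact fun x hx => hcog x (fun w => LinearMap.congr_fun hx w)
  have hDD : IsFiniteLength k ((M →ₗ[k] E) →ₗ[k] E) :=
    Module.length_ne_top_iff.1 ((length_dual_le hE1 hD).trans_lt
      (Module.length_ne_top_iff.2 hD).lt_top).ne
  have htop : LinearMap.range ev = ⊤ := by
    by_contra hne
    obtain ⟨_, _⟩ := isFiniteLength_iff_isNoetherian_isArtinian.1 hDD
    have h1 := Submodule.length_lt hne
    rw [← (LinearEquiv.ofInjective ev hev).length_eq] at h1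
    exact absurd ((length_dual_le hE1 hD).trans (length_dual_le hE1 hM)) (not_le.2 h1)
  intro φ
  obtain ⟨x, rfl⟩ : φ ∈ LinearMap.range ev := htop ▸ Submodule.mem_top
  exact ⟨x, fun w => rfl⟩

end Matlis

section AlmostSplit

/-- A matrix condition detecting split monomorphisms starting in `X`: if every column in `X` that
becomes divisible by `A` after applying `h` is already divisible by `A`, then `h` splits. -/
theorem exists_matrix_detecting_split (k : Type u) [CommRing k] [IsArtinianRing k]
    (Λ : Type u) [Ring Λ] [Algebra k Λ] [Module.Finite k Λ]
    (X : Type v) [AddCommGroup X] [Module Λ X] (hX : IsFiniteLength Λ X) :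
    ∃ (n m : ℕ) (A : Fin n → Fin m → Λ), ∀ (Z : Type v) [AddCommGroup Z] [Module Λ Z]
      (h : X →ₗ[Λ] Z),
      (∀ x : Fin n → X, (∃ z : Fin m → Z, ∀ p, h (x p) = ∑ j, A p j • z j) →
        ∃ y : Fin m → X, ∀ p, x p = ∑ j, A p j • y j) →
      ∃ r : Z →ₗ[Λ] X, r.comp h = LinearMap.id := by
  obtain ⟨E, hB, hE⟩ := exists_duality_module.{u, v} k
  let : Module k X := Module.compHom X (algebraMap k Λ)
  have : IsScalarTower k Λ X := IsScalarTower.of_algebraMap_smul fun _ _ => rfl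
  have hXk : IsFiniteLength k X := by
    obtain ⟨_, _⟩ := isFiniteLength_iff_isNoetherian_isArtinian.1 hX
    have : Module.Finite k X := Module.Finite.trans Λ X
    exact isFiniteLength_iff_isNoetherian_isArtinian.2 ⟨inferInstance, inferInstance⟩
  obtain ⟨hD, hcog, hrefl⟩ := hE X hXk
  have hDfin : Module.Finite k (X →ₗ[k] E) := by
    have := (isFiniteLength_iff_isNoetherian_isArtinian.1 hD).1
    infer_instance
  obtain ⟨n, w, hw⟩ := Module.Finite.exists_fin (R := k) (M := X →ₗ[k] E)
  -- `b l x = ∑ p, w p (l p • x)`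
  let b : (Fin n → Λ) →ₗ[k] X →ₗ[k] E :=
    ∑ p, ((LinearMap.llcomp k X X E (w p)) ∘ₗ (Algebra.lsmul k k X).toLinearMap) ∘ₗ
      LinearMap.proj p
  have hb : ∀ l x, b l x = ∑ p, w p (l p • x) := by
    intro l x
    simp [b]
  have hbsurj : ∀ f : X →ₗ[k] E, ∃ l, b l = f := by
    intro f
    have hf : f ∈ Submodule.span k (Set.range w) := hw ▸ Submodule.mem_top
    obtain ⟨c, rfl⟩ := (Submodule.mem_span_range_iff_exists_fun k).1 hf
    refine ⟨fun p => algebraMap k Λ (c p), ?_⟩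
    ext x
    rw [hb]
    simp
  obtain ⟨m, ρ, hρ⟩ := Module.Finite.exists_fin (R := k) (M := LinearMap.ker b)
  refine ⟨n, m, fun p j => (ρ j : Fin n → Λ) p, fun Z _ _ h hdiv => ?_⟩
  let : Module k Z := Module.compHom Z (algebraMap k Λ)
  have : IsScalarTower k Λ Z := IsScalarTower.of_algebraMap_smul fun _ _ => rfl
  let A : ∀ (W : Type v) [AddCommGroup W] [Module k W] [Module Λ W] [IsScalarTower k Λ W],
      (Fin m → W) →ₗ[k] (Fin n → W) := fun W _ _ _ _ =>
    LinearMap.pi fun p => ∑ j, (Algebra.lsmul k k W ((ρ j : Fin n → Λ) p)) ∘ₗ LinearMap.proj j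
  have hA : ∀ (W : Type v) [AddCommGroup W] [Module k W] [Module Λ W] [IsScalarTower k Λ W]
      (z : Fin m → W) (p : Fin n), A W z p = ∑ j, (ρ j : Fin n → Λ) p • z j := by
    intro W _ _ _ _ z p
    simp [A]
  let ε : (Fin n → X) →ₗ[k] E := ∑ p, w p ∘ₗ LinearMap.proj p
  have hε : ∀ x, ε x = ∑ p, w p (x p) := fun x => by simp [ε]
  let H : (Fin n → X) →ₗ[k] (Fin n → Z) ⧸ LinearMap.range (A Z) :=
    (LinearMap.range (A Z)).mkQ ∘ₗ (h.restrictScalars k).compLeft (Fin n)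
  have hker : LinearMap.ker H ≤ LinearMap.ker ε := by
    intro x hx
    have hx' := (Submodule.Quotient.mk_eq_zero _).1 (LinearMap.mem_ker.1 hx)
    obtain ⟨z, hz⟩ := hx'
    obtain ⟨y, hy⟩ := hdiv x ⟨z, fun p => by rw [← hA Z, hz]; rfl⟩
    rw [LinearMap.mem_ker, hε]
    simp_rw [hy, map_sum]
    rw [Finset.sum_comm]
    refine Finset.sum_eq_zero fun j _ => ?_
    rw [← hb, (ρ j).2, LinearMap.zero_apply]
  obtain ⟨α, hα⟩ := hB.extension_property ((LinearMap.ker H).liftQ H le_rfl)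
    (LinearMap.ker_eq_bot.1 (Submodule.ker_liftQ_eq_bot _ _ _ le_rfl))
    ((LinearMap.ker H).liftQ ε hker)
  have hαH : ∀ x, α (H x) = ε x := fun x =>
    LinearMap.congr_fun hα (Submodule.Quotient.mk x)
  -- for fixed `z`, the functional `l ↦ α (l • z)` on `Λ ^ n`
  let ψ : Z → (Fin n → Λ) →ₗ[k] E := fun z =>
    α ∘ₗ (LinearMap.range (A Z)).mkQ ∘ₗ
      ((LinearMap.toSpanSingleton Λ Z z).restrictScalars k).compLeft (Fin n)
  have hψ : ∀ z l, ψ z l = α (Submodule.Quotient.mk fun p => l p • z) := fun z l => rfl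
  have hψker : ∀ z, LinearMap.ker b ≤ LinearMap.ker (ψ z) := by
    intro z l hl
    have hl' : (⟨l, hl⟩ : LinearMap.ker b) ∈ Submodule.span k (Set.range ρ) :=
      hρ ▸ Submodule.mem_top
    obtain ⟨c, hc⟩ := (Submodule.mem_span_range_iff_exists_fun k).1 hl'
    rw [LinearMap.mem_ker, hψ]
    have : (Submodule.Quotient.mk fun p => l p • z : (Fin n → Z) ⧸ LinearMap.range (A Z)) = 0 := by
      refine (Submodule.Quotient.mk_eq_zero _).2 ⟨fun j => c j • z, ?_⟩
      funext p
      rw [hA]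
      have hlp : l p = ∑ j, c j • (ρ j : Fin n → Λ) p := by
        have := congrFun (congrArg Subtype.val hc) p
        simpa using this.symm
      rw [hlp, Finset.sum_smul]
      refine Finset.sum_congr rfl fun j _ => ?_
      rw [smul_assoc, smul_comm]
    rw [this, map_zero]
  have hex : ∀ z, ∃ x : X, ∀ l, ψ z l = b l x := by
    intro z
    let e := b.quotKerEquivOfSurjective hbsurj
    obtain ⟨x, hx⟩ := hrefl (((LinearMap.ker b).liftQ (ψ z) (hψker z)) ∘ₗ e.symm.toLinearMap)
    refine ⟨x, fun l => ?_⟩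
    rw [← hx]
    have : e.symm (b l) = Submodule.Quotient.mk l := by
      rw [LinearEquiv.symm_apply_eq]
      rfl
    simp [this]
  have huniq : ∀ x y : X, (∀ l, b l x = b l y) → x = y := by
    intro x y hxy
    rw [← sub_eq_zero]
    refine hcog _ fun f => ?_
    obtain ⟨l, rfl⟩ := hbsurj f
    rw [map_sub, hxy, sub_self]
  choose r hr using hex
  have hadd : ∀ z z', r (z + z') = r z + r z' := by
    intro z z'
    refine huniq _ _ fun l => ?_
    rw [map_add, ← hr, ← hr, ← hr, hψ, hψ, hψ, ← map_add, ← Submodule.Quotient.mk_add]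
    congr 2
    funext p
    exact smul_add _ _ _
  have hsmul : ∀ (c : Λ) z, r (c • z) = c • r z := by
    intro c z
    refine huniq _ _ fun l => ?_
    have h1 : b l (c • r z) = b (fun p => l p * c) (r z) := by
      simp [hb, mul_smul]
    rw [h1, ← hr, ← hr, hψ, hψ]
    congr 2
    funext p
    exact (mul_smul _ _ _).symm
  refine ⟨⟨⟨r, hadd⟩, hsmul⟩, ?_⟩
  ext x
  refine huniq _ _ fun l => ?_
  change b l (r (h x)) = b l x
  rw [← hr, hψ, hb]
  have h1 : (fun p => l p • h x) = (h.restrictScalars k).compLeft (Fin n) (fun p => l p • x) := by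
    funext p
    exact (h.map_smul _ _).symm
  rw [h1]
  exact (hαH _).trans (hε _)

end AlmostSplit

section LeftAlmostSplit

variable {Λ : Type u} [Ring Λ]

theorem IndecMod.bijective_or_bijective_of_add_eq_id {X : Type v} [AddCommGroup X] [Module Λ X]
    [IsNoetherian Λ X] [IsArtinian Λ X] (hX : IndecMod Λ X) {a b : X →ₗ[Λ] X}
    (hab : a + b = LinearMap.id) : Function.Bijective a ∨ Function.Bijective b := by
  obtain ⟨n, hn, hn1⟩ := (a.eventually_isCompl_ker_pow_range_pow.and
    (Filter.eventually_ge_atTop 1)).exists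
  rcases hX.2 _ _ le_top le_top hn.sup_eq_top hn.inf_eq_bot with h | h
  · left
    apply IsArtinian.bijective_of_injective_endomorphism
    rw [← LinearMap.ker_eq_bot, eq_bot_iff, ← h]
    intro x hx
    obtain ⟨m, rfl⟩ := Nat.exists_eq_add_of_le' hn1
    rw [LinearMap.mem_ker] at hx ⊢
    rw [pow_succ, Module.End.mul_apply, hx, map_zero]
  · right
    have hnil : IsNilpotent a := ⟨n, LinearMap.range_eq_bot.1 h⟩
    have hb : b = 1 - a := by rw [eq_sub_iff_add_eq, add_comm, hab]; rfl
    rw [hb]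
    exact (Module.End.isUnit_iff _).1 hnil.isUnit_one_sub

theorem IsSplitMonoHom.of_comp_bijective {X Z : Type v} [AddCommGroup X] [Module Λ X]
    [AddCommGroup Z] [Module Λ Z] {h : X →ₗ[Λ] Z} (r : Z →ₗ[Λ] X)
    (hr : Function.Bijective (r.comp h)) : IsSplitMonoHom Λ h := by
  refine ⟨(LinearEquiv.ofBijective _ hr).symm.toLinearMap.comp r, ?_⟩
  ext x
  exact (LinearEquiv.ofBijective _ hr).symm_apply_apply x

theorem IndecMod.isSplitMonoHom_or_of_prod {X Z Z' : Type v} [AddCommGroup X] [Module Λ X]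
    [IsNoetherian Λ X] [IsArtinian Λ X] [AddCommGroup Z] [Module Λ Z]
    [AddCommGroup Z'] [Module Λ Z'] (hX : IndecMod Λ X) {h : X →ₗ[Λ] Z} {h' : X →ₗ[Λ] Z'}
    (hh : IsSplitMonoHom Λ (h.prod h')) : IsSplitMonoHom Λ h ∨ IsSplitMonoHom Λ h' := by
  obtain ⟨r, hr⟩ := hh
  have key : (r.comp (LinearMap.inl Λ Z Z')).comp h + (r.comp (LinearMap.inr Λ Z Z')).comp h' =
      LinearMap.id := by
    rw [← hr]
    ext x
    simp [← map_add]
  exact (hX.bijective_or_bijective_of_add_eq_id key).imp (IsSplitMonoHom.of_comp_bijective _)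
    (IsSplitMonoHom.of_comp_bijective _)

/-- A map `f` is left almost split if it is not a split monomorphism and every map of the same
source which is not a split monomorphism factors through `f`. -/
def IsLeftAlmostSplit {X E : Type v} [AddCommGroup X] [Module Λ X] [AddCommGroup E] [Module Λ E]
    (f : X →ₗ[Λ] E) : Prop :=
  ¬ IsSplitMonoHom Λ f ∧ ∀ (Z : Type v) [AddCommGroup Z] [Module Λ Z], IsFiniteLength Λ Z →
    ∀ h : X →ₗ[Λ] Z, ¬ IsSplitMonoHom Λ h → ∃ g : E →ₗ[Λ] Z, g.comp f = h

/-- The columns in `X` which become divisible by the matrix `A` after applying `h`. -/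
def divisibleColumns (k : Type u) [CommRing k] [Algebra k Λ] {X Z : Type v} [AddCommGroup X]
    [Module Λ X] [Module k X] [IsScalarTower k Λ X] [AddCommGroup Z] [Module Λ Z] {n m : ℕ}
    (A : Fin n → Fin m → Λ) (h : X →ₗ[Λ] Z) : Submodule k (Fin n → X) where
  carrier := {x | ∃ z : Fin m → Z, ∀ p, h (x p) = ∑ j, A p j • z j}
  zero_mem' := ⟨0, by simp⟩
  add_mem' := by
    rintro x y ⟨z, hz⟩ ⟨w, hw⟩
    exact ⟨z + w, fun p => by simp [hz, hw, smul_add, Finset.sum_add_distrib]⟩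
  smul_mem' := by
    rintro c x ⟨z, hz⟩
    refine ⟨fun j => algebraMap k Λ c • z j, fun p => ?_⟩
    rw [Pi.smul_apply, ← algebraMap_smul Λ c (x p), map_smul, hz, Finset.smul_sum]
    exact Finset.sum_congr rfl fun j _ => by rw [smul_smul, smul_smul, Algebra.commutes]

/-- If `X` is indecomposable and has at least one non-split map, then there is a column of `X` not
divisible by a certain matrix, which becomes divisible along every non-split map. -/
theorem exists_universal_column (k : Type u) [CommRing k] [IsArtinianRing k] [Algebra k Λ]
    [Module.Finite k Λ] {X Y : Type v} [AddCommGroup X] [Module Λ X] [IsNoetherian Λ X]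
    [IsArtinian Λ X] (hX : IndecMod Λ X) [AddCommGroup Y] [Module Λ Y] (hY : IsFiniteLength Λ Y)
    (u : X →ₗ[Λ] Y) (hu : ¬ IsSplitMonoHom Λ u) :
    ∃ (n m : ℕ) (A : Fin n → Fin m → Λ) (ξ : Fin n → X),
      (¬ ∃ y : Fin m → X, ∀ p, ξ p = ∑ j, A p j • y j) ∧
      ∀ (Z : Type v) [AddCommGroup Z] [Module Λ Z], IsFiniteLength Λ Z → ∀ h : X →ₗ[Λ] Z,
        ¬ IsSplitMonoHom Λ h → ∃ z : Fin m → Z, ∀ p, h (ξ p) = ∑ j, A p j • z j := by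
  let : Module k X := Module.compHom X (algebraMap k Λ)
  have : IsScalarTower k Λ X := IsScalarTower.of_algebraMap_smul fun _ _ => rfl
  have : Module.Finite k X := Module.Finite.trans Λ X
  obtain ⟨n, m, A, hA⟩ := exists_matrix_detecting_split k Λ X
    (isFiniteLength_iff_isNoetherian_isArtinian.2 ⟨inferInstance, inferInstance⟩)
  obtain ⟨K, ⟨Z, hZ, h, hh, rfl⟩, hmin⟩ := WellFounded.has_min
    (wellFounded_lt (α := Submodule k (Fin n → X)))
    {K | ∃ (Z : ModuleCat.{v} Λ) (_ : IsFiniteLength Λ Z) (h : X →ₗ[Λ] Z),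
      ¬ IsSplitMonoHom Λ h ∧ K = divisibleColumns k A h}
    ⟨_, ModuleCat.of Λ Y, hY, u, hu, rfl⟩
  have hex : ∃ ξ ∈ divisibleColumns k A h, ¬ ∃ y : Fin m → X, ∀ p, ξ p = ∑ j, A p j • y j := by
    by_contra! hcon
    refine hh (hA Z h fun x hx => ?_)
    exact hcon x hx
  obtain ⟨ξ, hξ, hξA⟩ := hex
  refine ⟨n, m, A, ξ, hξA, fun Z' _ _ hZ' h' hh' => ?_⟩
  obtain ⟨_, _⟩ := isFiniteLength_iff_isNoetherian_isArtinian.1 hZ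
  obtain ⟨_, _⟩ := isFiniteLength_iff_isNoetherian_isArtinian.1 hZ'
  have hle : divisibleColumns k A (h.prod h') ≤ divisibleColumns k A h := by
    rintro x ⟨z, hz⟩
    refine ⟨fun j => (z j).1, fun p => ?_⟩
    simpa [Prod.fst_sum] using congrArg Prod.fst (hz p)
  have hle' : divisibleColumns k A (h.prod h') ≤ divisibleColumns k A h' := by
    rintro x ⟨z, hz⟩
    refine ⟨fun j => (z j).2, fun p => ?_⟩
    simpa [Prod.snd_sum] using congrArg Prod.snd (hz p)
  have hns : ¬ IsSplitMonoHom Λ (h.prod h') := fun hs =>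
    (hX.isSplitMonoHom_or_of_prod hs).elim hh hh'
  have := hmin (divisibleColumns k A (h.prod h')) ⟨ModuleCat.of Λ (Z × Z'),
    isFiniteLength_iff_isNoetherian_isArtinian.2
      ⟨inferInstanceAs (IsNoetherian Λ (Z × Z')), inferInstanceAs (IsArtinian Λ (Z × Z'))⟩,
    h.prod h', hns, rfl⟩
  rw [← eq_of_le_of_not_lt hle this] at hξ
  exact hle' hξ

theorem exists_isLeftAlmostSplit (k : Type u) [CommRing k] [IsArtinianRing k] [Algebra k Λ]
    [Module.Finite k Λ] {X Y : Type v} [AddCommGroup X] [Module Λ X] [IsNoetherian Λ X]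
    [IsArtinian Λ X] (hX : IndecMod Λ X) [AddCommGroup Y] [Module Λ Y] (hY : IsFiniteLength Λ Y)
    (u : X →ₗ[Λ] Y) (hu : ¬ IsSplitMonoHom Λ u) :
    ∃ (E : ModuleCat.{v} Λ) (_ : IsFiniteLength Λ E) (f : X →ₗ[Λ] E), IsLeftAlmostSplit f := by
  obtain ⟨n, m, A, ξ, hξA, hξ⟩ := exists_universal_column k hX hY u hu
  have : IsArtinianRing Λ := IsArtinianRing.of_finite k Λ
  let Φ (Z : Type v) [AddCommGroup Z] [Module Λ Z] (h : X →ₗ[Λ] Z) (z : Fin m → Z) :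
      X × (Fin m → Λ) →ₗ[Λ] Z := h.coprod (Fintype.linearCombination Λ z)
  have hΦ (Z : Type v) [AddCommGroup Z] [Module Λ Z] (h : X →ₗ[Λ] Z) (z : Fin m → Z) (x e) :
      Φ Z h z (x, e) = h x + ∑ j, e j • z j := rfl
  obtain ⟨K, ⟨Z, hZ, h, z, hz, rfl⟩, hmin⟩ := WellFounded.has_min
    (wellFounded_lt (α := Submodule Λ (X × (Fin m → Λ))))
    {K | ∃ (Z : ModuleCat.{v} Λ) (_ : IsFiniteLength Λ Z) (h : X →ₗ[Λ] Z) (z : Fin m → Z),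
      (∀ p, h (ξ p) = ∑ j, A p j • z j) ∧ K = LinearMap.ker (Φ Z h z)}
    (by
      obtain ⟨z, hz⟩ := hξ Y hY u hu
      exact ⟨_, ModuleCat.of Λ Y, hY, u, z, hz, rfl⟩)
  obtain ⟨_, _⟩ := isFiniteLength_iff_isNoetherian_isArtinian.1 hZ
  let R := LinearMap.range (Φ Z h z)
  have hfR (x) : h x ∈ R := ⟨(x, 0), by simp [hΦ]⟩
  have hzR (j) : z j ∈ R := ⟨(0, Pi.single j 1), by simp [hΦ, Pi.single_apply, ite_smul]⟩
  refine ⟨ModuleCat.of Λ R, isFiniteLength_iff_isNoetherian_isArtinian.2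
    ⟨inferInstanceAs (IsNoetherian Λ R), inferInstanceAs (IsArtinian Λ R)⟩,
    (h.codRestrict R hfR : X →ₗ[Λ] R), ?_, ?_⟩
  · rintro ⟨r, hr⟩
    refine hξA ⟨fun j => r ⟨z j, hzR j⟩, fun p => ?_⟩
    have h1 : r (h.codRestrict R hfR (ξ p)) = ξ p := LinearMap.congr_fun hr (ξ p)
    have h2 : h.codRestrict R hfR (ξ p) = ∑ j, A p j • (⟨z j, hzR j⟩ : R) := by
      ext
      simp [hz]
    rw [← h1, h2, map_sum]
    exact Finset.sum_congr rfl fun j _ => map_smul r _ _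
  · intro Z' _ _ hZ' h' hh'
    obtain ⟨z', hz'⟩ := hξ Z' hZ' h' hh'
    obtain ⟨_, _⟩ := isFiniteLength_iff_isNoetherian_isArtinian.1 hZ'
    have hker (t) : Φ (Z × Z') (h.prod h') (fun j => (z j, z' j)) t =
        (Φ Z h z t, Φ Z' h' z' t) := by
      ext <;> simp [hΦ, Prod.fst_sum, Prod.snd_sum, Φ]
    have hlt := hmin (LinearMap.ker (Φ (Z × Z') (h.prod h') (fun j => (z j, z' j))))
      ⟨ModuleCat.of Λ (Z × Z'), isFiniteLength_iff_isNoetherian_isArtinian.2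
      ⟨inferInstanceAs (IsNoetherian Λ (Z × Z')), inferInstanceAs (IsArtinian Λ (Z × Z'))⟩,
        h.prod h', fun j => (z j, z' j), fun p => by
          ext <;> simp [hz, hz', Prod.fst_sum, Prod.snd_sum], rfl⟩
    have hle : LinearMap.ker (Φ (Z × Z') (h.prod h') (fun j => (z j, z' j))) ≤
        LinearMap.ker (Φ Z h z) := by
      intro t ht
      rw [LinearMap.mem_ker, hker] at ht
      exact congrArg Prod.fst ht
    have hle' : LinearMap.ker (Φ Z h z) ≤ LinearMap.ker (Φ Z' h' z') := by
      rw [← eq_of_le_of_not_lt hle hlt]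
      intro t ht
      rw [LinearMap.mem_ker, hker] at ht
      exact congrArg Prod.snd ht
    refine ⟨((LinearMap.ker (Φ Z h z)).liftQ (Φ Z' h' z') hle').comp
      (Φ Z h z).quotKerEquivRange.symm.toLinearMap, ?_⟩
    ext x
    have h1 : (Φ Z h z).quotKerEquivRange (Submodule.Quotient.mk (x, 0)) =
        h.codRestrict R hfR x := by
      ext
      simp [hΦ]
    have h2 : (Φ Z h z).quotKerEquivRange.symm (h.codRestrict R hfR x) =
        Submodule.Quotient.mk (x, 0) := by rw [← h1, LinearEquiv.symm_apply_apply]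
    have h3 : (LinearMap.ker (Φ Z h z)).liftQ (Φ Z' h' z') hle'
        ((Φ Z h z).quotKerEquivRange.symm (h.codRestrict R hfR x)) = h' x := by
      rw [h2, Submodule.liftQ_apply, hΦ]
      simp
    exact h3

/-- A left almost split map with target of minimal length is left minimal. -/
theorem exists_isLeftAlmostSplit_minimal (k : Type u) [CommRing k] [IsArtinianRing k]
    [Algebra k Λ] [Module.Finite k Λ] {X Y : Type v} [AddCommGroup X] [Module Λ X]
    [IsNoetherian Λ X] [IsArtinian Λ X] (hX : IndecMod Λ X) [AddCommGroup Y] [Module Λ Y]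
    (hY : IsFiniteLength Λ Y) (u : X →ₗ[Λ] Y) (hu : ¬ IsSplitMonoHom Λ u) :
    ∃ (E : ModuleCat.{v} Λ) (_ : IsFiniteLength Λ E) (f : X →ₗ[Λ] E), IsLeftAlmostSplit f ∧
      ∀ θ : E →ₗ[Λ] E, θ.comp f = f → Function.Bijective θ := by
  obtain ⟨E₀, hE₀, f₀, hf₀⟩ := exists_isLeftAlmostSplit k hX hY u hu
  obtain ⟨l, ⟨E, hE, f, hf, rfl⟩, hmin⟩ := WellFounded.has_min (wellFounded_lt (α := ℕ∞))
    {l | ∃ (E : ModuleCat.{v} Λ) (_ : IsFiniteLength Λ E) (f : X →ₗ[Λ] E),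
      IsLeftAlmostSplit f ∧ l = Module.length Λ E} ⟨_, E₀, hE₀, f₀, hf₀, rfl⟩
  refine ⟨E, hE, f, hf, fun θ hθ => ?_⟩
  obtain ⟨_, _⟩ := isFiniteLength_iff_isNoetherian_isArtinian.1 hE
  suffices hs : Function.Surjective θ from
    IsNoetherian.bijective_of_surjective_endomorphism θ hs
  by_contra hns
  have hfR (x) : f x ∈ LinearMap.range θ := ⟨f x, LinearMap.congr_fun hθ x⟩
  refine hmin (Module.length Λ (LinearMap.range θ)) ⟨ModuleCat.of Λ (LinearMap.range θ),
    isFiniteLength_iff_isNoetherian_isArtinian.2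
      ⟨inferInstanceAs (IsNoetherian Λ (LinearMap.range θ)),
        inferInstanceAs (IsArtinian Λ (LinearMap.range θ))⟩,
    f.codRestrict (LinearMap.range θ) hfR, ⟨?_, ?_⟩, rfl⟩ ?_
  · rintro ⟨r, hr⟩
    refine hf.1 ⟨r.comp θ.rangeRestrict, ?_⟩
    rw [← hr]
    ext x
    change r (θ.rangeRestrict (f x)) = r (f.codRestrict (LinearMap.range θ) hfR x)
    congr 1
    ext
    exact LinearMap.congr_fun hθ x
  · intro Z _ _ hZ h hh
    obtain ⟨g, rfl⟩ := hf.2 Z hZ h hh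
    exact ⟨g.comp (LinearMap.range θ).subtype, rfl⟩
  · refine Submodule.length_lt ?_
    rw [ne_eq, LinearMap.range_eq_top]
    exact hns

theorem IsLeftAlmostSplit.isIrreducibleHom_comp {X E M : Type v} [AddCommGroup X] [Module Λ X]
    [AddCommGroup E] [Module Λ E] [AddCommGroup M] [Module Λ M] {f : X →ₗ[Λ] E}
    (hf : IsLeftAlmostSplit f) (hmin : ∀ θ : E →ₗ[Λ] E, θ.comp f = f → Function.Bijective θ)
    {i : M →ₗ[Λ] E} {p : E →ₗ[Λ] M} (hpi : p.comp i = LinearMap.id)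
    (hinj : Function.Injective (p.comp f)) :
    IsIrreducibleHom Λ (p.comp f) := by
  have hns : ¬ IsSplitMonoHom Λ (p.comp f) := fun ⟨r, hr⟩ => hf.1 ⟨r.comp p, hr⟩
  have hpi' (y) : p (i y) = y := LinearMap.congr_fun hpi y
  refine ⟨hns, ?_, fun Z _ _ hZ h g hgh => ?_⟩
  · rintro ⟨s, hs⟩
    refine hns ⟨s, ?_⟩
    ext x
    apply hinj
    exact LinearMap.congr_fun hs _
  · by_cases hh : IsSplitMonoHom Λ h
    · exact Or.inl hh
    right
    obtain ⟨h', rfl⟩ := hf.2 Z hZ h hh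
    let θ : E →ₗ[Λ] E := i.comp (g.comp h') + (LinearMap.id - i.comp p)
    have hθ : Function.Bijective θ := hmin θ <| by
      ext x
      have h1 : p (f x) = g (h' (f x)) := LinearMap.congr_fun hgh x
      simp [θ, h1]
    let e := LinearEquiv.ofBijective θ hθ
    have hpθ (y) : p (θ y) = g (h' y) := by simp [θ, hpi']
    refine ⟨(h'.comp e.symm.toLinearMap).comp i, ?_⟩
    ext y
    have h2 : θ (e.symm (i y)) = i y := e.apply_symm_apply (i y)
    change g (h' (e.symm (i y))) = y
    rw [← hpθ, h2, hpi']

end LeftAlmostSplit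

section IndecomposableSummands

variable {Λ : Type u} [Ring Λ]

theorem exists_indecomposable_summand {Y : Type v} [AddCommGroup Y] [Module Λ Y]
    (E : ModuleCat.{v} Λ) (hE : IsFiniteLength Λ E) (g : E →ₗ[Λ] Y) (w : E) (hw : g w ≠ 0) :
    ∃ (M : ModuleCat.{v} Λ) (_ : IsFiniteLength Λ M) (_ : IndecMod Λ M) (i : M →ₗ[Λ] E)
      (p : E →ₗ[Λ] M), p.comp i = LinearMap.id ∧ g (i (p w)) ≠ 0 := by
  induction hl : Module.length Λ E using WellFoundedLT.induction generalizing E with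
  | ind l ih =>
  subst hl
  by_cases hind : IndecMod Λ E
  · exact ⟨E, hE, hind, LinearMap.id, LinearMap.id, rfl, hw⟩
  obtain ⟨_, _⟩ := isFiniteLength_iff_isNoetherian_isArtinian.1 hE
  have key (A B : Submodule Λ E) (hAB : IsCompl A B) (hB : B ≠ ⊥)
      (hA : g (A.projection B hAB w) ≠ 0) : ∃ (M : ModuleCat.{v} Λ) (_ : IsFiniteLength Λ M)
      (_ : IndecMod Λ M) (i : M →ₗ[Λ] E) (p : E →ₗ[Λ] M),
      p.comp i = LinearMap.id ∧ g (i (p w)) ≠ 0 := by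
    obtain ⟨M, hM, hMi, i, p, hpi, hg⟩ := ih (Module.length Λ A)
      (Submodule.length_lt fun h => hB (by simpa [h] using hAB.inf_eq_bot)) (ModuleCat.of Λ A)
      (isFiniteLength_iff_isNoetherian_isArtinian.2
        ⟨inferInstanceAs (IsNoetherian Λ A), inferInstanceAs (IsArtinian Λ A)⟩)
      (g.comp A.subtype) (A.projectionOnto B hAB w) hA rfl
    refine ⟨M, hM, hMi, A.subtype.comp i, (p : A →ₗ[Λ] M).comp (A.projectionOnto B hAB), ?_, hg⟩
    ext x
    have h1 : A.projectionOnto B hAB ((i x : A) : E) = i x :=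
      Submodule.projectionOnto_apply_left hAB _
    change p (A.projectionOnto B hAB ((i x : A) : E)) = x
    rw [h1]
    exact LinearMap.congr_fun hpi x
  have htop : (⊤ : Submodule Λ E) ≠ ⊥ := fun h => hw <| by
    have : w ∈ (⊤ : Submodule Λ E) := trivial
    rw [h, Submodule.mem_bot] at this
    rw [this, map_zero]
  rw [IndecMod, IndecSub] at hind
  push Not at hind
  obtain ⟨A, B, -, -, hsup, hinf, hA, hB⟩ := hind htop
  have hAB : IsCompl A B := ⟨disjoint_iff.2 hinf, codisjoint_iff.2 hsup⟩
  by_cases hgA : g (A.projection B hAB w) = 0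
  · refine key B A hAB.symm hA fun hgB => hw ?_
    rw [← Submodule.projection_add_projection_eq_self hAB w, map_add, hgA, hgB, add_zero]
  · exact key A B hAB hB hgA

theorem IndecMod.indecSub_range {M Y : Type v} [AddCommGroup M] [Module Λ M] [AddCommGroup Y]
    [Module Λ Y] (hM : IndecMod Λ M) {f : M →ₗ[Λ] Y} (hf : Function.Injective f) :
    IndecSub Λ (LinearMap.range f) := by
  refine ⟨fun h => hM.1 ?_, fun A B hA hB hsup hinf => ?_⟩
  · rw [LinearMap.range_eq_bot] at h
    rw [eq_bot_iff]
    intro x _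
    exact hf (by simp [h])
  · have hA' : (A.comap f).map f = A := Submodule.map_comap_eq_of_le hA
    have hB' : (B.comap f).map f = B := Submodule.map_comap_eq_of_le hB
    refine (hM.2 (A.comap f) (B.comap f) le_top le_top ?_ ?_).imp (fun h => ?_) (fun h => ?_)
    · apply Submodule.map_injective_of_injective hf
      rw [Submodule.map_sup, hA', hB', hsup, LinearMap.range_eq_map]
    · rw [← Submodule.comap_inf, hinf, ← LinearMap.ker, LinearMap.ker_eq_bot.2 hf]
    · rw [← hA', h, Submodule.map_bot]
    · rw [← hB', h, Submodule.map_bot]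

theorem IndecSub.indecMod {Y : Type v} [AddCommGroup Y] [Module Λ Y] {N : Submodule Λ Y}
    (hN : IndecSub Λ N) : IndecMod Λ N := by
  refine ⟨fun h => hN.1 ?_, fun A B _ _ hsup hinf => ?_⟩
  · rw [← N.map_subtype_top, h, Submodule.map_bot]
  · refine (hN.2 (A.map N.subtype) (B.map N.subtype) (N.map_subtype_le A) (N.map_subtype_le B)
      ?_ ?_).imp (fun h => ?_) (fun h => ?_)
    · rw [← Submodule.map_sup, hsup, N.map_subtype_top]
    · rw [← Submodule.map_inf _ N.injective_subtype, hinf, Submodule.map_bot]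
    · exact Submodule.map_injective_of_injective N.injective_subtype (by rw [h, Submodule.map_bot])
    · exact Submodule.map_injective_of_injective N.injective_subtype (by rw [h, Submodule.map_bot])

/-- A map which is nonzero at `x` can be replaced by one with smaller, indecomposable image which
is still nonzero at `x`. -/
theorem exists_indecSub_range_le {X Y : Type v} [AddCommGroup X] [Module Λ X] [AddCommGroup Y]
    [Module Λ Y] [IsNoetherian Λ Y] [IsArtinian Λ Y] (f : X →ₗ[Λ] Y) {x : X} (hx : f x ≠ 0) :
    ∃ f' : X →ₗ[Λ] Y, f' x ≠ 0 ∧ LinearMap.range f' ≤ LinearMap.range f ∧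
      IndecSub Λ (LinearMap.range f') := by
  obtain ⟨M, -, hM, i, p, hpi, hg⟩ := exists_indecomposable_summand
    (ModuleCat.of Λ (LinearMap.range f)) (isFiniteLength_iff_isNoetherian_isArtinian.2
      ⟨inferInstanceAs (IsNoetherian Λ (LinearMap.range f)),
        inferInstanceAs (IsArtinian Λ (LinearMap.range f))⟩)
    (LinearMap.range f).subtype (f.rangeRestrict x) hx
  let j : M →ₗ[Λ] Y := (LinearMap.range f).subtype.comp i
  let q : X →ₗ[Λ] M := (p : LinearMap.range f →ₗ[Λ] M).comp f.rangeRestrict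
  have hp : Function.Surjective p := fun y => ⟨i y, LinearMap.congr_fun hpi y⟩
  have hi : Function.Injective i := Function.LeftInverse.injective (LinearMap.congr_fun hpi)
  have hq : Function.Surjective q := hp.comp f.surjective_rangeRestrict
  have hj : Function.Injective j := (LinearMap.range f).injective_subtype.comp hi
  have hr : LinearMap.range (j.comp q) = LinearMap.range j :=
    LinearMap.range_comp_of_range_eq_top _ (LinearMap.range_eq_top.2 hq)
  refine ⟨j.comp q, hg, ?_, ?_⟩
  · rintro _ ⟨y, rfl⟩
    exact (i (q y) : LinearMap.range f).2
  · rw [hr]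
    exact hM.indecSub_range hj

end IndecomposableSummands

section GabrielRoiterMeasure

variable {Λ : Type u} [Ring Λ] {Y : Type v} [AddCommGroup Y] [Module Λ Y]

theorem not_indecSub_bot : ¬ IndecSub Λ (⊥ : Submodule Λ Y) := fun h => h.1 rfl

theorem muAux_bot (n : ℕ) : muAux Λ n (⊥ : Submodule Λ Y) = 0 := by
  cases n <;> simp [muAux, not_indecSub_bot]

theorem mu_bot : mu Λ (⊥ : Submodule Λ Y) = 0 := muAux_bot _

variable [IsNoetherian Λ Y] [IsArtinian Λ Y]

theorem subLen_strictMono : StrictMono (subLen Λ : Submodule Λ Y → ℕ) := by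
  intro N N' h
  rw [← ENat.natCast_lt_natCast, subLen, subLen, ENat.natCast_toNat N.height_lt_top.ne,
    ENat.natCast_toNat N'.height_lt_top.ne]
  exact Submodule.height_strictMono h

theorem subLen_mono : Monotone (subLen Λ : Submodule Λ Y → ℕ) := subLen_strictMono.monotone

theorem eq_bot_of_subLen_le_zero {N : Submodule Λ Y} (h : subLen Λ N ≤ 0) : N = ⊥ := by
  by_contra hN
  exact absurd (subLen_strictMono (bot_lt_iff_ne_bot.2 hN)) (by omega)

theorem muAux_eq_muAux {n m : ℕ} {N : Submodule Λ Y} (hn : subLen Λ N ≤ n)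
    (hm : subLen Λ N ≤ m) : muAux Λ n N = muAux Λ m N := by
  induction n generalizing m N with
  | zero => rw [eq_bot_of_subLen_le_zero hn, muAux_bot, muAux_bot]
  | succ n ih =>
    cases m with
    | zero => rw [eq_bot_of_subLen_le_zero hm, muAux_bot, muAux_bot]
    | succ m =>
      rw [muAux, muAux]
      congr 2
      refine Set.image_congr fun N' hN' => ?_
      have := subLen_strictMono (Λ := Λ) hN'
      exact ih (by omega) (by omega)

open Classical in
theorem mu_eq (N : Submodule Λ Y) : mu Λ N =
    (if IndecSub Λ N then (2 : ℝ) ^ (-(subLen Λ N : ℤ)) else 0) +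
      sSup (mu Λ '' {N' : Submodule Λ Y | N' < N}) := by
  rw [mu, muAux_eq_muAux le_rfl (Nat.le_succ _), muAux]
  congr 2
  exact Set.image_congr fun N' hN' => muAux_eq_muAux (subLen_mono (Λ := Λ) (le_of_lt hN')) le_rfl

theorem exists_mu_eq_div {L : ℕ} {N : Submodule Λ Y} (hN : subLen Λ N ≤ L) :
    ∃ a : ℕ, a < 2 ^ L ∧ mu Λ N = a / 2 ^ L := by
  induction L generalizing N with
  | zero => exact ⟨0, by simp, by simp [eq_bot_of_subLen_le_zero hN, mu_bot]⟩
  | succ L ih =>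
    rcases hN.lt_or_eq with h | h
    · obtain ⟨a, ha, hNa⟩ := ih (Nat.lt_succ_iff.1 h)
      refine ⟨2 * a, by rw [pow_succ']; omega, ?_⟩
      rw [hNa, pow_succ']
      push_cast
      field_simp
    · have hsub : mu Λ '' {N' : Submodule Λ Y | N' < N} ⊆
          (fun b : ℕ => (b : ℝ) / 2 ^ L) '' Set.Iio (2 ^ L) := by
        rintro _ ⟨N', hN', rfl⟩
        have := subLen_strictMono (Λ := Λ) hN'
        obtain ⟨a, ha, hNa⟩ := ih (N := N') (by omega)
        exact ⟨a, ha, hNa.symm⟩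
      have hbot : (⊥ : Submodule Λ Y) < N := by
        refine bot_lt_iff_ne_bot.2 fun h' => ?_
        simp [h', subLen] at h
      obtain ⟨b, hb, hNb⟩ := hsub ((Set.Nonempty.image _ ⟨⊥, hbot⟩).csSup_mem
        (((Set.finite_Iio _).image _).subset hsub))
      rw [mu_eq, ← hNb, h]
      rw [Set.mem_Iio] at hb
      split_ifs
      · refine ⟨2 * b + 1, by rw [pow_succ']; omega, ?_⟩
        rw [zpow_neg, zpow_natCast, pow_succ']
        push_cast
        field_simp
        ring
      · refine ⟨2 * b, by rw [pow_succ']; omega, ?_⟩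
        rw [pow_succ']
        push_cast
        field_simp
        ring

theorem finite_range_mu : (Set.range (mu Λ : Submodule Λ Y → ℝ)).Finite := by
  refine ((Set.finite_Iio (2 ^ subLen Λ (⊤ : Submodule Λ Y))).image
    (fun b : ℕ => (b : ℝ) / 2 ^ subLen Λ (⊤ : Submodule Λ Y))).subset ?_
  rintro _ ⟨N, rfl⟩
  obtain ⟨a, ha, hNa⟩ := exists_mu_eq_div (subLen_mono (Λ := Λ) (le_top (a := N)))
  exact ⟨a, ha, hNa.symm⟩

theorem mu_le_sSup {N N' : Submodule Λ Y} (h : N' < N) :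
    mu Λ N' ≤ sSup (mu Λ '' {N' : Submodule Λ Y | N' < N}) :=
  le_csSup (finite_range_mu.subset (Set.image_subset_range _ _)).bddAbove ⟨N', h, rfl⟩

theorem exists_lt_mu_eq_sSup {N : Submodule Λ Y} (h : N ≠ ⊥) :
    ∃ N' < N, mu Λ N' = sSup (mu Λ '' {N' : Submodule Λ Y | N' < N}) :=
  Set.Nonempty.csSup_mem (s := mu Λ '' {N' : Submodule Λ Y | N' < N})
    (Set.Nonempty.image _ ⟨⊥, bot_lt_iff_ne_bot.2 h⟩) (finite_range_mu.subset (Set.image_subset_range _ _))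

theorem mu_mono : Monotone (mu Λ : Submodule Λ Y → ℝ) := by
  intro N' N h
  rcases h.lt_or_eq with h | rfl
  · rw [mu_eq N]
    have := mu_le_sSup h
    split_ifs
    · have : (0 : ℝ) < 2 ^ (-(subLen Λ N : ℤ)) := by positivity
      linarith
    · linarith
  · rfl

theorem IndecSub.mu_add_le {N N' : Submodule Λ Y} (hN : IndecSub Λ N) (h : N' < N) :
    mu Λ N' + (2 : ℝ) ^ (-(subLen Λ N : ℤ)) ≤ mu Λ N := by
  rw [mu_eq N, if_pos hN, add_comm]
  exact add_le_add_right (mu_le_sSup h) _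

theorem exists_indecSub_mu_eq (N : Submodule Λ Y) :
    ∃ N' ≤ N, (N' = ⊥ ∨ IndecSub Λ N') ∧ mu Λ N' = mu Λ N := by
  induction N using WellFoundedLT.induction with
  | ind N ih =>
  by_cases hN : N = ⊥ ∨ IndecSub Λ N
  · exact ⟨N, le_rfl, hN, rfl⟩
  · push Not at hN
    obtain ⟨N', hN', h⟩ := exists_lt_mu_eq_sSup hN.1
    obtain ⟨N'', hN'', h1, h2⟩ := ih N' hN'
    refine ⟨N'', hN''.trans hN'.le, h1, ?_⟩
    rw [h2, h, mu_eq N, if_neg hN.2, zero_add]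

theorem IndecSub.exists_lt_mu_eq {N : Submodule Λ Y} (hN : IndecSub Λ N) :
    ∃ N' < N, (N' = ⊥ ∨ IndecSub Λ N') ∧ mu Λ N = mu Λ N' + (2 : ℝ) ^ (-(subLen Λ N : ℤ)) := by
  obtain ⟨N', hN', h⟩ := exists_lt_mu_eq_sSup hN.1
  obtain ⟨N'', hN'', h1, h2⟩ := exists_indecSub_mu_eq N'
  refine ⟨N'', hN''.trans_lt hN', h1, ?_⟩
  rw [h2, h, mu_eq N, if_pos hN, add_comm]

theorem mu_add_le_of_mu_lt {L : ℕ} {N N' : Submodule Λ Y} (hN : subLen Λ N ≤ L)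
    (hN' : subLen Λ N' ≤ L) (h : mu Λ N < mu Λ N') :
    mu Λ N + (2 : ℝ) ^ (-(L : ℤ)) ≤ mu Λ N' := by
  obtain ⟨a, -, ha⟩ := exists_mu_eq_div hN
  obtain ⟨b, -, hb⟩ := exists_mu_eq_div hN'
  rw [ha, hb] at h ⊢
  have hab : a + 1 ≤ b := by
    rw [div_lt_div_iff_of_pos_right (by positivity)] at h
    exact_mod_cast h
  have hab' : (a : ℝ) + 1 ≤ b := by exact_mod_cast hab
  rw [zpow_neg, zpow_natCast, inv_eq_one_div, ← add_div]
  gcongr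

theorem IndecSub.mu_ne_of_subLen_lt {N V : Submodule Λ Y} (hN : IndecSub Λ N)
    (hV : subLen Λ V < subLen Λ N) : mu Λ V ≠ mu Λ N := by
  intro h
  obtain ⟨N', hN', -, hmu⟩ := hN.exists_lt_mu_eq
  have hlt := subLen_strictMono (Λ := Λ) hN'
  obtain ⟨L, hL⟩ : ∃ L, subLen Λ N = L + 1 := ⟨subLen Λ N - 1, by omega⟩
  obtain ⟨a, -, ha⟩ := exists_mu_eq_div (N := V) (L := L) (by omega)
  obtain ⟨b, -, hb⟩ := exists_mu_eq_div (N := N') (L := L) (by omega)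
  rw [ha, hmu, hb, hL, zpow_neg, zpow_natCast, pow_succ'] at h
  field_simp at h
  have : 2 * a = 2 * b + 1 := by exact_mod_cast (by linarith : (2 : ℝ) * a = 2 * b + 1)
  omega

end GabrielRoiterMeasure

section MainProperty

variable {Λ : Type u} [Ring Λ] {Y : Type v} [AddCommGroup Y] [Module Λ Y]

theorem subLen_eq_toNat_length (N : Submodule Λ Y) : subLen Λ N = (Module.length Λ N).toNat := by
  rw [Module.length_submodule, subLen]

variable [IsNoetherian Λ Y] [IsArtinian Λ Y]

theorem subLen_range_le {X : Submodule Λ Y} (f : X →ₗ[Λ] Y) :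
    subLen Λ (LinearMap.range f) ≤ subLen Λ X := by
  rw [subLen_eq_toNat_length, subLen_eq_toNat_length]
  exact ENat.toNat_le_toNat (Module.length_le_of_surjective f.rangeRestrict
    f.surjective_rangeRestrict) Module.length_ne_top

theorem subLen_range_lt {X : Submodule Λ Y} {f : X →ₗ[Λ] Y} (hf : ¬ Function.Injective f) :
    subLen Λ (LinearMap.range f) < subLen Λ X := by
  rw [subLen_eq_toNat_length, subLen_eq_toNat_length, ← ENat.natCast_lt_natCast,
    ENat.natCast_toNat Module.length_ne_top, ENat.natCast_toNat Module.length_ne_top,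
    ← f.quotKerEquivRange.length_eq]
  exact Submodule.length_quotient_lt _ fun h => hf (LinearMap.ker_eq_bot.1 h)

/-- Gabriel's main property: if a family of maps starting in an indecomposable module `X` is
jointly injective, then the image of one of the maps has measure at least `μ(X)`. -/
theorem IndecSub.exists_mu_le_mu_range {X : Submodule Λ Y} (hX : IndecSub Λ X)
    (G : Set (X →ₗ[Λ] Y)) (hG : ∀ x : X, x ≠ 0 → ∃ f ∈ G, f x ≠ 0) :
    ∃ f ∈ G, mu Λ X ≤ mu Λ (LinearMap.range f) := by
  induction X using WellFoundedLT.induction with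
  | ind X ih =>
  suffices h : ∃ f' : X →ₗ[Λ] Y, (∃ f ∈ G, LinearMap.range f' ≤ LinearMap.range f) ∧
      mu Λ X ≤ mu Λ (LinearMap.range f') by
    obtain ⟨f', ⟨f, hf, hle⟩, hmu⟩ := h
    exact ⟨f, hf, hmu.trans (mu_mono hle)⟩
  have href (x : X) (hx : x ≠ 0) : ∃ f' : X →ₗ[Λ] Y, f' x ≠ 0 ∧
      (∃ f ∈ G, LinearMap.range f' ≤ LinearMap.range f) ∧ IndecSub Λ (LinearMap.range f') := by
    obtain ⟨f, hf, hfx⟩ := hG x hx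
    obtain ⟨f', h1, h2, h3⟩ := exists_indecSub_range_le f hfx
    exact ⟨f', h1, ⟨f, hf, h2⟩, h3⟩
  obtain ⟨X', hlt, rfl | hX', hmu⟩ := hX.exists_lt_mu_eq
  · obtain ⟨x, hx, hx0⟩ := X.ne_bot_iff.1 hX.1
    obtain ⟨f', -, hf', hind⟩ := href ⟨x, hx⟩ (by simpa using hx0)
    refine ⟨f', hf', ?_⟩
    have h1 := hind.mu_add_le (bot_lt_iff_ne_bot.2 hind.1)
    have h2 : (2 : ℝ) ^ (-(subLen Λ X : ℤ)) ≤ 2 ^ (-(subLen Λ (LinearMap.range f') : ℤ)) :=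
      zpow_le_zpow_right₀ one_le_two (by have := subLen_range_le f'; omega)
    rw [hmu]
    linarith
  · obtain ⟨_, ⟨f', ⟨hf', hind⟩, rfl⟩, hle⟩ := ih X' hlt hX'
      ((fun f : X →ₗ[Λ] Y => f.comp (Submodule.inclusion hlt.le)) ''
        {f' | (∃ f ∈ G, LinearMap.range f' ≤ LinearMap.range f) ∧
          IndecSub Λ (LinearMap.range f')}) (by
        intro x hx
        obtain ⟨f', h1, h2⟩ := href (Submodule.inclusion hlt.le x) fun h =>
          hx (Submodule.inclusion_injective hlt.le (by rw [h, map_zero]))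
        exact ⟨_, ⟨f', h2, rfl⟩, h1⟩)
    refine ⟨f', hf', ?_⟩
    have hVU : LinearMap.range (f'.comp (Submodule.inclusion hlt.le)) ≤ LinearMap.range f' :=
      LinearMap.range_comp_le_range _ _
    rcases hVU.lt_or_eq with hVU | hVU
    · have h1 := hind.mu_add_le hVU
      have h2 : (2 : ℝ) ^ (-(subLen Λ X : ℤ)) ≤ 2 ^ (-(subLen Λ (LinearMap.range f') : ℤ)) :=
        zpow_le_zpow_right₀ one_le_two (by have := subLen_range_le f'; omega)
      rw [hmu]
      linarith
    · have hninj : ¬ Function.Injective (f'.comp (Submodule.inclusion hlt.le)) := by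
        intro hinj
        have hsup : X'.comap X.subtype ⊔ LinearMap.ker f' = ⊤ := by
          rw [eq_top_iff]
          intro x _
          have : f' x ∈ LinearMap.range (f'.comp (Submodule.inclusion hlt.le)) := by
            rw [hVU]
            exact ⟨_, rfl⟩
          obtain ⟨y, hy⟩ := this
          rw [← add_sub_cancel (Submodule.inclusion hlt.le y) x]
          refine Submodule.add_mem_sup y.2 ?_
          rw [LinearMap.mem_ker, map_sub, ← hy]
          exact sub_self _
        have hinf : X'.comap X.subtype ⊓ LinearMap.ker f' = ⊥ := by
          rw [eq_bot_iff]
          rintro ⟨x, hxX⟩ ⟨hx, hxk⟩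
          have h1 : f'.comp (Submodule.inclusion hlt.le) ⟨x, hx⟩ = 0 := hxk
          have h2 : (⟨x, hx⟩ : X') = 0 := hinj (by rw [h1, map_zero])
          have h3 : x = 0 := congrArg Subtype.val h2
          exact Subtype.ext h3
        rcases hX.indecMod.2 _ _ le_top le_top hsup hinf with h | h
        · obtain ⟨x, hx, hx0⟩ := X'.ne_bot_iff.1 hX'.1
          have : (⟨x, hlt.le hx⟩ : X) ∈ X'.comap X.subtype := hx
          rw [h, Submodule.mem_bot] at this
          exact hx0 (congrArg Subtype.val this)
        · rw [h, sup_bot_eq, Submodule.comap_subtype_eq_top] at hsup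
          exact hlt.not_ge hsup
      have hlen := subLen_range_lt hninj
      have hlt' := lt_of_le_of_ne hle (hX'.mu_ne_of_subLen_lt hlen).symm
      have h1 := mu_add_le_of_mu_lt le_rfl hlen.le hlt'
      have h2 : (2 : ℝ) ^ (-(subLen Λ X : ℤ)) ≤ 2 ^ (-(subLen Λ X' : ℤ)) :=
        zpow_le_zpow_right₀ one_le_two (by have := subLen_strictMono (Λ := Λ) hlt; omega)
      have h3 := mu_mono (Λ := Λ) hVU.le
      rw [hmu]
      change mu Λ X' + 2 ^ (-(subLen Λ X' : ℤ)) ≤ _ at h1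
      linarith

end MainProperty

theorem IsGRSub.not_isSplitMonoHom_subtype {Λ : Type u} [Ring Λ] {Y : Type v} [AddCommGroup Y]
    [Module Λ Y] {X : Submodule Λ Y} (hX : IsGRSub Λ X) : ¬ IsSplitMonoHom Λ X.subtype := by
  rintro ⟨r, hr⟩
  have hc : IsCompl X (LinearMap.ker r) := LinearMap.isCompl_of_proj (LinearMap.congr_fun hr)
  rcases hX.1.2 _ _ le_top le_top hc.sup_eq_top hc.inf_eq_bot with h | h
  · exact hX.2.1.1 h
  · exact hX.2.2.1 (by simpa [h] using hc.sup_eq_top)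

/-- If `X` is a Gabriel-Roiter submodule of some module `Y`, then there
exists an irreducible monomorphism `X → M` with `M` indecomposable. -/
theorem gabriel_roiter_stmt3
    (k : Type u) [CommRing k] [IsArtinianRing k]
    (Λ : Type u) [Ring Λ] [Algebra k Λ] [Module.Finite k Λ]
    (Y : Type v) [AddCommGroup Y] [Module Λ Y] (hYfl : IsFiniteLength Λ Y)
    (X : Submodule Λ Y) (hX : IsGRSub Λ X) :
    ∃ M : ModuleCat.{v} Λ, IsFiniteLength Λ M ∧ IndecMod Λ M ∧
      ∃ f : ↥X →ₗ[Λ] ↥M, IsIrreducibleHom Λ f ∧ Function.Injective f := by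
  obtain ⟨_, _⟩ := isFiniteLength_iff_isNoetherian_isArtinian.1 hYfl
  have hns := hX.not_isSplitMonoHom_subtype
  obtain ⟨E, hE, f, hf, hmin⟩ :=
    exists_isLeftAlmostSplit_minimal k hX.2.1.indecMod hYfl X.subtype hns
  obtain ⟨g, hg⟩ := hf.2 Y hYfl X.subtype hns
  by_contra hcon
  have hninj (M : ModuleCat.{v} Λ) (hM : IsFiniteLength Λ M) (hMi : IndecMod Λ M)
      (i : M →ₗ[Λ] E) (p : E →ₗ[Λ] M) (hpi : p.comp i = LinearMap.id) :
      ¬ Function.Injective (p.comp f) := fun hinj =>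
    hcon ⟨M, hM, hMi, p.comp f, hf.isIrreducibleHom_comp hmin hpi hinj, hinj⟩
  obtain ⟨q, hq, hmu⟩ := hX.2.1.exists_mu_le_mu_range
    {q : X →ₗ[Λ] Y | ¬ Function.Injective q} fun x hx => by
      have hgx : g (f x) ≠ 0 := by
        rw [← LinearMap.comp_apply, hg]
        simpa using hx
      obtain ⟨M, hM, hMi, i, p, hpi, hgw⟩ := exists_indecomposable_summand E hE g (f x) hgx
      refine ⟨(g.comp i).comp (p.comp f), fun hinj => hninj M hM hMi i p hpi ?_, hgw⟩
      exact Function.Injective.of_comp (f := g.comp i) hinj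
  have hlen := subLen_range_lt hq
  have hlt := lt_of_le_of_ne hmu (hX.2.1.mu_ne_of_subLen_lt hlen).symm
  have htop : LinearMap.range q < ⊤ := lt_top_iff_ne_top.2 fun h => by
    rw [h] at hlen
    exact absurd (subLen_mono (Λ := Λ) (le_top (a := X))) (not_le.2 hlen)
  have h1 := IndecSub.mu_add_le hX.1 htop
  have h2 := hX.2.2.2
  linarith
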